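/- arXiv:2301.13533 — 8 statements merged into one kernel-verified Lean document; each statement's English description precedes it below -/
import Mathlib

section
/- Let h : ℝ → ℝ be differentiable, and let c_lo, c_hi ∈ ℝ with 0 < c_hi, such that c_lo ≤ h'(u) ≤ c_hi for every u ∈ ℝ. Then for every u, u* ∈ ℝ, writing ũ = u − u* and ỹ = h(u) − h(u*), one has (ỹ − c_lo·ũ)·((1/c_hi)·ỹ − ũ) ≤ 0; that is, the arbitrarily shifted static function is input-feedforward output-feedback passive with indices (c_lo, 1/c_hi). -/
/-- A differentiable static function with derivative bounded in
`[c_lo, c_hi]`, `0 < c_hi`, is IFOFP`(c_lo, 1/c_hi)` w.r.t. any shifted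
input-output pair. -/
theorem static_function_IFOFP (h : ℝ → ℝ) (hdiff : Differentiable ℝ h)
    (clo chi : ℝ) (hchi : 0 < chi)
    (hbound : ∀ u : ℝ, clo ≤ deriv h u ∧ deriv h u ≤ chi) :
    ∀ u ustar : ℝ,
      ((h u - h ustar) - clo * (u - ustar)) *
        ((1 / chi) * (h u - h ustar) - (u - ustar)) ≤ 0 := by
  intro u ustar
  have scale : (1 / chi) * (h u - h ustar) - (u - ustar) =
      ((h u - h ustar) - chi * (u - ustar)) / chi := by
    field_simp
  rw [scale, ← mul_div_assoc]
  refine div_nonpos_of_nonpos_of_nonneg ?_ hchi.le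
  rcases le_total ustar u with hle | hle
  · have lower := mul_sub_le_image_sub_of_le_deriv hdiff (fun x => (hbound x).1) hle
    have upper := image_sub_le_mul_sub_of_deriv_le hdiff (fun x => (hbound x).2) hle
    exact mul_nonpos_of_nonneg_of_nonpos (by linarith) (by linarith)
  · have lower := mul_sub_le_image_sub_of_le_deriv hdiff (fun x => (hbound x).1) hle
    have upper := image_sub_le_mul_sub_of_deriv_le hdiff (fun x => (hbound x).2) hle
    exact mul_nonpos_of_nonpos_of_nonneg (by linarith) (by linarith)
end

section
/- Let C > 0 and c_lo ∈ ℝ, and let ĩ_L : ℝ → ℝ satisfy the sector bound c_lo·s² ≤ s·ĩ_L(s) for all s ∈ ℝ. Let ṽ : ℝ → ℝ be differentiable and u : ℝ → ℝ be such that C·ṽ'(t) = −u(t) − ĩ_L(ṽ(t)) for all t. Then the storage function S(t) = (C/2)·ṽ(t)² satisfies S'(t) ≤ −ṽ(t)·u(t) − c_lo·ṽ(t)² for all t; i.e., the shifted load bus dynamics are output-feedback passive with index c_lo with respect to the input-output pair (−u, ṽ). -/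
/-- The shifted load bus dynamics `C·ṽ' = −u − ĩ_L(ṽ)` with a
sector-bounded load are OFP`(c_lo)` w.r.t. the pair `(−u, ṽ)` for the storage
function `S = (C/2)·ṽ²`. -/
theorem load_bus_OFP (C clo : ℝ) (hC : 0 < C) (iL : ℝ → ℝ)
    (hsector : ∀ s : ℝ, clo * s ^ 2 ≤ s * iL s)
    (v u : ℝ → ℝ) (hv : Differentiable ℝ v)
    (hdyn : ∀ t, C * deriv v t = -u t - iL (v t)) :
    ∀ t, deriv (fun t => (C / 2) * (v t) ^ 2) t
      ≤ -(v t * u t) - clo * (v t) ^ 2 := by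
  intro t
  have hS : deriv (fun t => (C / 2) * (v t) ^ 2) t = v t * (C * deriv v t) := by
    refine (((hv t).hasDerivAt.pow 2).const_mul (C / 2)).deriv.trans ?_
    push_cast
    ring
  rw [hS, hdyn t]
  linarith [hsector (v t)]
end

section
/- Let v_c > 0 and z, i₀, p ∈ ℝ, and define z_c = z + i₀/v_c + p/v_c². Define the ZIP load function i_L : (0, ∞) → ℝ by i_L(v) = z·v + i₀ + p/v for v ≥ v_c and i_L(v) = z_c·v for 0 < v < v_c. Then for all v, w ∈ (0, ∞) with v ≠ w, the difference quotient satisfies (i_L(v) − i_L(w))/(v − w) ≥ min(z, z − p/v_c², z_c). -/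
/-- On `[a, ∞)` the map `v ↦ z v + i₀ + p / v` has slope at least `min z (z - p / a²)`. -/
lemma mul_sub_le_ZIP_sub {a z i₀ p m v w : ℝ} (ha : 0 < a) (hz : m ≤ z)
    (hp : m ≤ z - p / a ^ 2) (haw : a ≤ w) (hwv : w ≤ v) :
    m * (v - w) ≤ (z * v + i₀ + p / v) - (z * w + i₀ + p / w) := by
  have hw : 0 < w := ha.trans_le haw
  have hv : 0 < v := hw.trans_le hwv
  have slope : (z * v + i₀ + p / v) - (z * w + i₀ + p / w) = (z - p / (v * w)) * (v - w) := by
    field_simp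
    ring
  rw [slope]
  refine mul_le_mul_of_nonneg_right ?_ (sub_nonneg.2 hwv)
  rcases le_total p 0 with h | h
  · have : p / (v * w) ≤ 0 := div_nonpos_of_nonpos_of_nonneg h (mul_pos hv hw).le
    linarith
  · have : p / (v * w) ≤ p / a ^ 2 :=
      div_le_div_of_nonneg_left h (by positivity) (by nlinarith)
    linarith

/-- The difference quotient of the ZIP load function (purely
resistive below the critical voltage `v_c`) is bounded below by
`min(z, z − p/v_c², z_c)`. -/
theorem ZIP_load_slope_bound (vc z i₀ p zc : ℝ) (hvc : 0 < vc)
    (hzc : zc = z + i₀ / vc + p / vc ^ 2)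
    (iL : ℝ → ℝ)
    (hiL : ∀ v : ℝ, 0 < v →
      iL v = if vc ≤ v then z * v + i₀ + p / v else zc * v) :
    ∀ v w : ℝ, 0 < v → 0 < w → v ≠ w →
      min z (min (z - p / vc ^ 2) zc) ≤ (iL v - iL w) / (v - w) := by
  set m := min z (min (z - p / vc ^ 2) zc)
  have hz : m ≤ z := min_le_left _ _
  have hp : m ≤ z - p / vc ^ 2 := (min_le_right _ _).trans (min_le_left _ _)
  have hc : m ≤ zc := (min_le_right _ _).trans (min_le_right _ _)
  have continuity_at_vc : zc * vc = z * vc + i₀ + p / vc := by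
    rw [hzc]
    field_simp
  have increment : ∀ v w : ℝ, 0 < w → w < v → m * (v - w) ≤ iL v - iL w := by
    intro v w hw hwv
    rw [hiL v (hw.trans hwv), hiL w hw]
    split_ifs with h₁ h₂ h₂
    · exact mul_sub_le_ZIP_sub hvc hz hp h₂ hwv.le
    · have above := mul_sub_le_ZIP_sub (i₀ := i₀) hvc hz hp le_rfl h₁
      have below := mul_le_mul_of_nonneg_right hc (sub_nonneg.2 (not_le.1 h₂).le)
      linarith
    · exact absurd (h₂.trans hwv.le) h₁
    · have below := mul_le_mul_of_nonneg_right hc (sub_nonneg.2 hwv.le)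
      linarith
  intro v w hv hw hne
  rcases hne.lt_or_gt with h | h
  · rw [← neg_div_neg_eq, neg_sub, neg_sub, le_div_iff₀ (sub_pos.2 h)]
    exact increment w v hv h
  · rw [le_div_iff₀ (sub_pos.2 h)]
    exact increment v w hw h
end

section
/- Let N ∈ ℕ, γ > 0, and let L_P, L_I ∈ ℝ^{N×N} with L_P symmetric positive semidefinite. Let x, z : ℝ → ℝ^N be differentiable and u : ℝ → ℝ^N be such that x'(t) = (−γ·I − L_P)·x(t) + L_Iᵀ·z(t) + γ·u(t) and z'(t) = −L_I·x(t) for all t. Then the storage function S(t) = (1/(2γ))·(x(t)ᵀx(t) + z(t)ᵀz(t)) satisfies S'(t) ≤ x(t)ᵀu(t) − x(t)ᵀx(t) for all t; i.e., the dynamic distributed averaging (DDA) controller with output y = x is output-feedback passive with index 1. -/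
open Matrix

/-- The derivative of the squared Euclidean length `v ⬝ᵥ v` along a differentiable curve. -/
theorem HasDerivAt.dotProduct_self {ι : Type*} [Fintype ι] {v : ℝ → ι → ℝ} {v' : ι → ℝ} {t : ℝ}
    (hv : HasDerivAt v v' t) :
    HasDerivAt (fun s => v s ⬝ᵥ v s) (2 * (v t ⬝ᵥ v')) t := by
  have hcoord := hasDerivAt_pi.mp hv
  have hsum : HasDerivAt (fun s => ∑ i, v s i * v s i) (∑ i, (v' i * v t i + v t i * v' i)) t :=
    HasDerivAt.fun_sum fun i _ => (hcoord i).mul (hcoord i)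
  refine hsum.congr_deriv ?_
  simp only [dotProduct, Finset.mul_sum]
  exact Finset.sum_congr rfl fun i _ => by ring

/-- The PI-DDA controller `ẋ = (−γI − L_P)x + L_Iᵀz + γu`,
`ż = −L_I x`, with output `y = x` is OFP(1) for the storage function
`S = (1/(2γ))(xᵀx + zᵀz)`, provided `L_P` is symmetric positive semidefinite. -/
theorem DDA_OFP (N : ℕ) (γ : ℝ) (hγ : 0 < γ)
    (LP LI : Matrix (Fin N) (Fin N) ℝ) (hLP : LP.PosSemidef)
    (x z u : ℝ → Fin N → ℝ)
    (hx : ∀ t, HasDerivAt x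
      ((-γ) • x t - LP.mulVec (x t) + LIᵀ.mulVec (z t) + γ • u t) t)
    (hz : ∀ t, HasDerivAt z (-(LI.mulVec (x t))) t) :
    ∀ t, deriv (fun t => (1 / (2 * γ)) * (x t ⬝ᵥ x t + z t ⬝ᵥ z t)) t
      ≤ x t ⬝ᵥ u t - x t ⬝ᵥ x t := by
  intro t
  have hS := ((hx t).dotProduct_self.add (hz t).dotProduct_self).const_mul (1 / (2 * γ))
  have hLP_nonneg : 0 ≤ x t ⬝ᵥ LP *ᵥ x t := by
    simpa using hLP.dotProduct_mulVec_nonneg (x t)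
  have hcross : x t ⬝ᵥ LIᵀ *ᵥ z t = z t ⬝ᵥ LI *ᵥ x t := by
    rw [mulVec_transpose, dotProduct_comm, ← dotProduct_mulVec]
  have hderiv : deriv (fun t => (1 / (2 * γ)) * (x t ⬝ᵥ x t + z t ⬝ᵥ z t)) t
      = x t ⬝ᵥ u t - x t ⬝ᵥ x t - (x t ⬝ᵥ LP *ᵥ x t) / γ := by
    refine hS.deriv.trans ?_
    simp only [dotProduct_add, dotProduct_sub, dotProduct_neg, dotProduct_smul, smul_eq_mul,
      hcross]
    field_simp
    ring
  rw [hderiv]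
  exact sub_le_self _ (div_nonneg hLP_nonneg hγ.le)
end

section
/- Let a, b ∈ ℝ and c ≥ 0. Define the dead-zone function g_c : ℝ → ℝ by g_c(u) = u + c if u < −c, g_c(u) = 0 if −c ≤ u ≤ c, and g_c(u) = u − c if u > c, and define the weighting function h(u) = a·u + b·g_c(u) − b·tanh(g_c(u)). Then h is differentiable on all of ℝ (including at u = ±c), and its derivative satisfies h'(u) = a + b·tanh(g_c(u))² for every u ∈ ℝ. -/
theorem hasDerivAt_tanh (x : ℝ) : HasDerivAt Real.tanh (1 - Real.tanh x ^ 2) x := by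
  have hx : Real.cosh x ≠ 0 := (Real.cosh_pos x).ne'
  have hd := (Real.hasDerivAt_sinh x).div (Real.hasDerivAt_cosh x) hx
  have hf : Real.tanh = Real.sinh / Real.cosh := by
    funext y
    simp [Real.tanh_eq_sinh_div_cosh]
  have hv : 1 - Real.tanh x ^ 2 =
      (Real.cosh x * Real.cosh x - Real.sinh x * Real.sinh x) / Real.cosh x ^ 2 := by
    rw [Real.tanh_eq_sinh_div_cosh]
    field_simp
  rw [hv, hf]
  exact hd

theorem hasDerivAt_id_sub_tanh (x : ℝ) :
    HasDerivAt (fun y => y - Real.tanh y) (Real.tanh x ^ 2) x := by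
  simpa using (hasDerivAt_id' x).fun_sub (hasDerivAt_tanh x)

theorem continuous_tanh : Continuous Real.tanh :=
  continuous_iff_continuousAt.2 fun x => (hasDerivAt_tanh x).continuousAt

/-- Freezing a function at `0` on the negative half-line keeps it differentiable when its
derivative is continuous and vanishes at `0`. -/
theorem hasDerivAt_comp_max_zero {f f' : ℝ → ℝ} (hf : ∀ x, HasDerivAt f (f' x) x)
    (hf' : Continuous f') (h0 : f' 0 = 0) (x : ℝ) :
    HasDerivAt (fun y => f (max y 0)) (f' (max x 0)) x := by
  have hfc : Continuous f := continuous_iff_continuousAt.2 fun y => (hf y).continuousAt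
  refine hasDerivAt_of_hasDerivAt_of_ne' (f := fun y => f (max y 0))
    (g := fun y => f' (max y 0)) (x := 0) (fun y hy => ?_)
    (by fun_prop) (by fun_prop) x
  rcases lt_or_gt_of_ne hy with hy | hy
  · rw [max_eq_right hy.le, h0]
    refine (hasDerivAt_const y (f 0)).congr_of_eventuallyEq ?_
    filter_upwards [Iio_mem_nhds hy] with z hz
    rw [max_eq_right (le_of_lt hz)]
  · rw [max_eq_left hy.le]
    refine (hf y).congr_of_eventuallyEq ?_
    filter_upwards [Ioi_mem_nhds hy] with z hz
    rw [max_eq_left (le_of_lt hz)]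

/-- The weighting function `h(u) = a·u + b·g_c(u) − b·tanh(g_c(u))`
built from the dead-zone `g_c` is differentiable on all of ℝ with derivative
`h'(u) = a + b·tanh(g_c(u))²`. -/
theorem weighting_function_differentiable (a b c : ℝ) (hc : 0 ≤ c)
    (g h : ℝ → ℝ)
    (hg : ∀ u : ℝ, g u = if u < -c then u + c else if u ≤ c then 0 else u - c)
    (hh : ∀ u : ℝ, h u = a * u + b * g u - b * Real.tanh (g u)) :
    Differentiable ℝ h ∧ ∀ u : ℝ, deriv h u = a + b * (Real.tanh (g u)) ^ 2 := by
  have split (f : ℝ → ℝ) (h0 : f 0 = 0) (u : ℝ) :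
      f (g u) = f (max (u - c) 0) + (f (u + c) - f (max (u + c) 0)) := by
    rw [hg u]
    split_ifs with h₁ h₂
    · rw [max_eq_right (by linarith), max_eq_right (by linarith), h0]
      ring
    · rw [max_eq_right (by linarith), max_eq_left (by linarith), h0]
      ring
    · rw [max_eq_left (by linarith), max_eq_left (by linarith)]
      ring
  have hmax := hasDerivAt_comp_max_zero hasDerivAt_id_sub_tanh (continuous_tanh.pow 2)
    (by simp)
  have key (u : ℝ) : HasDerivAt h (a + b * Real.tanh (g u) ^ 2) u := by
    have hfun : h = fun u => a * u + b * ((max (u - c) 0 - Real.tanh (max (u - c) 0)) +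
        ((u + c - Real.tanh (u + c)) - (max (u + c) 0 - Real.tanh (max (u + c) 0)))) := by
      funext v
      rw [hh, ← split (fun y => y - Real.tanh y) (by simp) v]
      ring
    rw [hfun, split (fun y => Real.tanh y ^ 2) (by simp) u]
    have hlin : HasDerivAt (fun v : ℝ => a * v) a u := by
      simpa using (hasDerivAt_id' u).const_mul a
    exact hlin.add ((((hmax (u - c)).comp_sub_const u c).add
      (((hasDerivAt_id_sub_tanh (u + c)).comp_add_const u c).sub
        ((hmax (u + c)).comp_add_const u c))).const_mul b)
  exact ⟨fun u => (key u).differentiableAt, fun u => (key u).deriv⟩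
end

section
/- Let a, b, c ∈ ℝ with a > 0, b > −a, and c ≥ 0. Define the dead-zone function g_c : ℝ → ℝ by g_c(u) = u + c if u < −c, g_c(u) = 0 if −c ≤ u ≤ c, and g_c(u) = u − c if u > c, and define the weighting function h(u) = a·u + b·g_c(u) − b·tanh(g_c(u)). Then h is strictly monotonically increasing on ℝ. -/
theorem monotone_tanh : Monotone Real.tanh :=
  monotone_of_hasDerivAt_nonneg hasDerivAt_tanh
    fun x => sub_nonneg.2 (Real.tanh_sq_lt_one x).le

theorem monotone_sub_tanh : Monotone fun x : ℝ => x - Real.tanh x := by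
  refine monotone_of_hasDerivAt_nonneg
    (fun x => (hasDerivAt_id x).sub (hasDerivAt_tanh x)) fun x => ?_
  simpa using sq_nonneg (Real.tanh x)

/-- For `a > 0`, `b > −a`, `c ≥ 0`, the weighting function
`h(u) = a·u + b·g_c(u) − b·tanh(g_c(u))` is strictly monotonically
increasing. -/
theorem weighting_function_strictMono (a b c : ℝ)
    (ha : 0 < a) (hb : -a < b) (hc : 0 ≤ c)
    (g h : ℝ → ℝ)
    (hg : ∀ u : ℝ, g u = if u < -c then u + c else if u ≤ c then 0 else u - c)
    (hh : ∀ u : ℝ, h u = a * u + b * g u - b * Real.tanh (g u)) :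
    StrictMono h := by
  intro u v huv
  obtain ⟨hg_mono, hg_lip⟩ : g u ≤ g v ∧ g v - g u ≤ v - u := by
    rw [hg u, hg v]
    constructor <;> split_ifs <;> linarith
  have h_tanh : Real.tanh (g u) ≤ Real.tanh (g v) := monotone_tanh hg_mono
  have h_sub : g u - Real.tanh (g u) ≤ g v - Real.tanh (g v) := monotone_sub_tanh hg_mono
  rw [hh u, hh v]
  rcases le_total 0 b with hb0 | hb0
  · nlinarith [mul_nonneg hb0 (sub_nonneg.2 h_sub), mul_pos ha (sub_pos.2 huv)]
  · have h_le : (g v - Real.tanh (g v)) - (g u - Real.tanh (g u)) ≤ v - u := by linarith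
    nlinarith [mul_le_mul_of_nonpos_left h_le hb0,
      mul_pos (neg_lt_iff_pos_add.1 hb) (sub_pos.2 huv)]
end

section
/- Let L, C, k_i > 0 and let R, R_d, k_p, v_eq, i_eq ∈ ℝ, and let ĩ_L : ℝ → ℝ satisfy ĩ_L(0) = 0. Let ẽ, ĩ, ṽ : ℝ → ℝ be differentiable functions satisfying the zero-input shifted DGU dynamics ẽ'(t) = −(ṽ(t) + v_eq)·ĩ(t) − i_eq·ṽ(t), L·ĩ'(t) = k_i·ẽ(t) + (R_d − R − k_p·(ṽ(t) + v_eq))·ĩ(t) − (1 + k_p·i_eq)·ṽ(t), and C·ṽ'(t) = ĩ(t) − ĩ_L(ṽ(t)) for all t. If the output satisfies ṽ(t) = 0 for all t, then ĩ(t) = 0 and ẽ(t) = 0 for all t; i.e., the shifted DGU dynamics are zero-state observable. -/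
/-- The shifted power-controlled DGU dynamics with zero exogenous
inputs are zero-state observable: identically zero output `ṽ ≡ 0` implies
`ĩ ≡ 0` and `ẽ ≡ 0`. -/
theorem DGU_zero_state_observable (L C ki R Rd kp veq ieq : ℝ)
    (hL : 0 < L) (hC : 0 < C) (hki : 0 < ki)
    (iL : ℝ → ℝ) (hiL0 : iL 0 = 0)
    (e i v : ℝ → ℝ)
    (he : Differentiable ℝ e) (hi : Differentiable ℝ i)
    (hv : Differentiable ℝ v)
    (hde : ∀ t, deriv e t = -((v t + veq) * i t) - ieq * v t)
    (hdi : ∀ t, L * deriv i t =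
      ki * e t + (Rd - R - kp * (v t + veq)) * i t - (1 + kp * ieq) * v t)
    (hdv : ∀ t, C * deriv v t = i t - iL (v t))
    (hout : ∀ t, v t = 0) :
    (∀ t, i t = 0) ∧ (∀ t, e t = 0) := by
  obtain rfl : v = fun _ => 0 := funext hout
  have hi0 : ∀ t, i t = 0 := fun t => by
    have h := hdv t
    simp only [deriv_const, hiL0] at h
    linarith
  obtain rfl : i = fun _ => 0 := funext hi0
  refine ⟨hi0, fun t => ?_⟩
  have h := hdi t
  simp only [deriv_const, mul_zero, add_zero, sub_zero] at h
  exact (mul_eq_zero.mp h.symm).resolve_left hki.ne'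
end

section
/- Let N ≥ 1, let G be a connected simple graph on the vertex set Fin N with real Laplacian matrix L, and let γ > 0, k_P > 0, k_I > 0. Suppose x, z, u ∈ ℝ^N satisfy the DDA equilibrium equations 0 = −γ·x − k_P·(L·x) + k_I·(Lᵀ·z) + γ·u and 0 = −k_I·(L·x). Then every component of x equals the average of the input: x_k = (Σ_{j} u_j)/N for all k. In particular, all components of x are equal. -/
open Matrix

/-- The entries of `Lᵀ z` sum to zero, where `L` is the Laplacian matrix of a graph. -/
theorem SimpleGraph.sum_transpose_lapMatrix_mulVec {V R : Type*} [Fintype V] [DecidableEq V]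
    [CommRing R] (G : SimpleGraph V) [DecidableRel G.Adj] (z : V → R) :
    ∑ i, ((G.lapMatrix R)ᵀ.mulVec z) i = 0 := by
  have h : (fun _ ↦ 1) ⬝ᵥ ((G.lapMatrix R)ᵀ.mulVec z) = 0 := by
    rw [Matrix.dotProduct_mulVec, Matrix.vecMul_transpose, G.lapMatrix_mulVec_const_eq_zero,
      zero_dotProduct]
  simpa [dotProduct] using h

/-- At an equilibrium of the DDA controller over a connected
communication graph, every component of the consensus state equals the average
of the input. -/
theorem DDA_equilibrium_average (N : ℕ) (hN : 1 ≤ N)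
    (G : SimpleGraph (Fin N)) [DecidableRel G.Adj] (hG : G.Connected)
    (γ kP kI : ℝ) (hγ : 0 < γ) (hkP : 0 < kP) (hkI : 0 < kI)
    (x z u : Fin N → ℝ)
    (h1 : (0 : Fin N → ℝ) =
      (-γ) • x - kP • ((G.lapMatrix ℝ).mulVec x)
        + kI • ((G.lapMatrix ℝ)ᵀ.mulVec z) + γ • u)
    (h2 : (0 : Fin N → ℝ) = -(kI • ((G.lapMatrix ℝ).mulVec x))) :
    (∀ k : Fin N, x k = (∑ j, u j) / N) ∧ ∀ k l : Fin N, x k = x l := by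
  have hLx : (G.lapMatrix ℝ).mulVec x = 0 := by
    simpa [hkI.ne'] using h2.symm
  have hconst : ∀ k l : Fin N, x k = x l := fun k l ↦
    G.lapMatrix_mulVec_eq_zero_iff_forall_reachable.mp hLx k l (hG.preconnected k l)
  refine ⟨fun k ↦ ?_, hconst⟩
  have hsum : γ * ∑ i, x i = γ * ∑ i, u i := by
    have h := congrArg (fun v : Fin N → ℝ ↦ ∑ i, v i) h1
    simp only [hLx, smul_zero, sub_zero, Pi.zero_apply, Pi.add_apply, Pi.smul_apply, smul_eq_mul,
      Finset.sum_add_distrib, ← Finset.mul_sum, G.sum_transpose_lapMatrix_mulVec,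
      Finset.sum_const_zero] at h
    linarith
  have hN' : (N : ℝ) ≠ 0 := by positivity
  rw [← mul_left_cancel₀ hγ.ne' hsum, Finset.sum_congr rfl fun i _ ↦ hconst i k]
  simp [hN']
end
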